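/- arXiv:1211.3204 — 3 statements merged into one kernel-verified Lean document; each statement's English description precedes it below -/
import Mathlib

section
/- Let σ ⊆ ℚ^n be the simplicial cone spanned by a linearly independent family y_{i_1}, …, y_{i_d} ∈ ℤ^n. Then every element of the monoid σ ∩ ℤ^n is a finite sum, with nonnegative integer multiplicities, of elements of {y_{i_1}, …, y_{i_d}} ∪ Gen(σ). In other words, the monoid of lattice points of σ is generated by the spanning vectors together with Gen(σ). -/
/-- Coordinatewise cast of a lattice vector in `ℤ^n` to `ℚ^n`. -/
def castQ {n : ℕ} (v : Fin n → ℤ) : Fin n → ℚ := fun i => (v i : ℚ)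

/-- The simplicial cone in `ℚ^n` spanned (with nonnegative rational coefficients)
by the vectors `y j`, `j ∈ S`. -/
def coneOf {n N : ℕ} (y : Fin N → Fin n → ℤ) (S : Finset (Fin N)) : Set (Fin n → ℚ) :=
  {v | ∃ a : Fin N → ℚ, (∀ j ∈ S, 0 ≤ a j) ∧ v = ∑ j ∈ S, a j • castQ (y j)}

/-- `SBox(σ)`: lattice points expressible as `∑ a_j • y_j` with `0 ≤ a_j < 1`. -/
def sboxOf {n N : ℕ} (y : Fin N → Fin n → ℤ) (S : Finset (Fin N)) : Set (Fin n → ℤ) :=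
  {b | ∃ a : Fin N → ℚ, (∀ j ∈ S, 0 ≤ a j ∧ a j < 1) ∧
    castQ b = ∑ j ∈ S, a j • castQ (y j)}

/-- `Gen(σ)`: the nonzero elements of `SBox(σ)` that are irreducible in the monoid
of lattice points of `σ`, i.e. not a sum of two nonzero lattice points of `σ`. -/
def genOf {n N : ℕ} (y : Fin N → Fin n → ℤ) (S : Finset (Fin N)) : Set (Fin n → ℤ) :=
  {b | b ∈ sboxOf y S ∧ b ≠ 0 ∧
    ¬ ∃ u w : Fin n → ℤ, u ≠ 0 ∧ w ≠ 0 ∧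
      castQ u ∈ coneOf y S ∧ castQ w ∈ coneOf y S ∧ b = u + w}

theorem castQ_add {n : ℕ} (u v : Fin n → ℤ) : castQ (u + v) = castQ u + castQ v := by
  funext i; simp [castQ]

theorem castQ_eq_zero_iff {n : ℕ} {v : Fin n → ℤ} : castQ v = 0 ↔ v = 0 := by
  simp [castQ, funext_iff]

/-- A linearly independent family lies in a common affine hyperplane `ℓ = 1`. -/
theorem LinearIndependent.exists_dual_eq_one {K V ι : Type*} [Field K] [AddCommGroup V]
    [Module K V] {v : ι → V} (hv : LinearIndependent K v) :
    ∃ l : V →ₗ[K] K, ∀ i, l (v i) = 1 := by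
  obtain ⟨g, hg⟩ := LinearMap.exists_leftInverse_of_injective
    (Finsupp.linearCombination K v) (LinearMap.ker_eq_bot.2 hv)
  refine ⟨Finsupp.linearCombination K (fun _ => (1 : K)) ∘ₗ g, fun i => ?_⟩
  have h := LinearMap.congr_fun hg (Finsupp.single i 1)
  simp only [LinearMap.comp_apply, Finsupp.linearCombination_single, one_smul,
    LinearMap.id_apply] at h
  simp [h]

/-- A rational linear functional on `ℚ^n` becomes integral on `ℤ^n` after scaling by a
positive rational. -/
theorem exists_integral_multiple {n : ℕ} (l : (Fin n → ℚ) →ₗ[ℚ] ℚ) :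
    ∃ (q : ℚ) (f : (Fin n → ℤ) →+ ℤ), 0 < q ∧ ∀ v, (f v : ℚ) = q * l (castQ v) := by
  obtain ⟨d, hd⟩ := IsLocalization.exist_integer_multiples_of_finite (nonZeroDivisors ℤ)
    (fun i : Fin n => l (Pi.single i 1))
  choose c hc using hd
  have hd0 : ((d : ℤ) : ℚ) ≠ 0 := by exact_mod_cast nonZeroDivisors.ne_zero d.2
  refine ⟨((d : ℤ) : ℚ) ^ 2,
    { toFun := fun v => ∑ i, (d : ℤ) * c i * v i
      map_zero' := by simp
      map_add' := fun u v => by simp [mul_add, Finset.sum_add_distrib] }, by positivity, ?_⟩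
  intro v
  rw [LinearMap.pi_apply_eq_sum_univ l (castQ v), Finset.mul_sum]
  simp only [AddMonoidHom.coe_mk, ZeroHom.coe_mk, Int.cast_sum, Int.cast_mul]
  refine Finset.sum_congr rfl fun i _ => ?_
  have h := hc i
  simp only [algebraMap_int_eq, eq_intCast, zsmul_eq_mul] at h
  have hs : (fun j => if i = j then (1 : ℚ) else 0) = Pi.single i 1 := by
    funext j; simp [Pi.single_apply, eq_comm]
  rw [hs, h, smul_eq_mul, castQ]
  ring

/-- The lattice points of a simplicial cone carry an additive integer grading that is positive
away from the origin. -/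
theorem exists_positive_grading {n N : ℕ} (y : Fin N → Fin n → ℤ) (S : Finset (Fin N))
    (hLI : LinearIndependent ℚ (fun j : S => castQ (y (j : Fin N)))) :
    ∃ f : (Fin n → ℤ) →+ ℤ, ∀ v, castQ v ∈ coneOf y S → v ≠ 0 → 0 < f v := by
  obtain ⟨l, hl⟩ := hLI.exists_dual_eq_one
  obtain ⟨q, f, hq, hf⟩ := exists_integral_multiple l
  refine ⟨f, fun v ⟨a, ha, hv⟩ hv0 => ?_⟩
  have hlv : l (castQ v) = ∑ j ∈ S, a j := by
    rw [hv, map_sum]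
    exact Finset.sum_congr rfl fun j hj => by rw [map_smul, hl ⟨j, hj⟩, smul_eq_mul, mul_one]
  have hpos : 0 < ∑ j ∈ S, a j := by
    refine (Finset.sum_nonneg ha).lt_of_ne' fun h => hv0 (castQ_eq_zero_iff.1 ?_)
    rw [hv]
    exact Finset.sum_eq_zero fun j hj => by
      rw [(Finset.sum_eq_zero_iff_of_nonneg ha).1 h j hj, zero_smul]
  have : (0 : ℚ) < f v := by rw [hf, hlv]; positivity
  exact_mod_cast this

theorem castQ_ray_mem_coneOf {n N : ℕ} (y : Fin N → Fin n → ℤ) {S : Finset (Fin N)} {j : Fin N}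
    (hj : j ∈ S) : castQ (y j) ∈ coneOf y S := by
  refine ⟨Pi.single j 1, fun k _ => ?_, ?_⟩
  · by_cases h : k = j <;> simp [h]
  · simp [Pi.single_apply, ite_smul, hj]

/-- A lattice point of the cone lies in `SBox(σ)` unless a spanning vector can be subtracted
from it inside the cone. -/
theorem mem_sboxOf_or_exists_add_ray {n N : ℕ} (y : Fin N → Fin n → ℤ) (S : Finset (Fin N))
    {b : Fin n → ℤ} (hb : castQ b ∈ coneOf y S) :
    b ∈ sboxOf y S ∨ ∃ j ∈ S, ∃ u, castQ u ∈ coneOf y S ∧ b = y j + u := by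
  obtain ⟨a, ha, hab⟩ := hb
  by_cases h : ∀ j ∈ S, a j < 1
  · exact Or.inl ⟨a, fun j hj => ⟨ha j hj, h j hj⟩, hab⟩
  push Not at h
  obtain ⟨j, hj, hja⟩ := h
  refine Or.inr ⟨j, hj, b - y j, ⟨fun k => a k - (Pi.single j 1 : Fin N → ℚ) k, ?_, ?_⟩, by abel⟩
  · intro k hk
    by_cases h : k = j
    · subst h; simpa using hja
    · simpa [Pi.single_apply, h] using ha k hk
  · have hs := castQ_add (b - y j) (y j)
    rw [sub_add_cancel] at hs
    rw [← add_left_inj (castQ (y j)), ← hs, hab]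
    simp [sub_smul, Finset.sum_sub_distrib, Pi.single_apply, ite_smul, hj]

/-- Every lattice point of the simplicial cone `σ` spanned by the linearly independent
family `{y j : j ∈ S}` is a sum, with nonnegative integer multiplicities, of the spanning
vectors together with the elements of `Gen(σ)`: the monoid `σ ∩ ℤ^n` is generated by
`{y j : j ∈ S} ∪ Gen(σ)`. -/
theorem latticePoints_generated_by_rays_and_gen {n N : ℕ}
    (y : Fin N → Fin n → ℤ) (S : Finset (Fin N))
    (hLI : LinearIndependent ℚ (fun j : S => castQ (y (j : Fin N))))
    (b : Fin n → ℤ) (hb : castQ b ∈ coneOf y S) :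
    b ∈ AddSubmonoid.closure ((y '' (S : Set (Fin N))) ∪ genOf y S) := by
  obtain ⟨f, hf⟩ := exists_positive_grading y S hLI
  induction hm : (f b).toNat using Nat.strong_induction_on generalizing b with
  | _ m ih =>
    by_cases hb0 : b = 0
    · exact hb0 ▸ zero_mem _
    by_cases hirr : ∃ u w : Fin n → ℤ, u ≠ 0 ∧ w ≠ 0 ∧
        castQ u ∈ coneOf y S ∧ castQ w ∈ coneOf y S ∧ b = u + w
    · obtain ⟨u, w, hu0, hw0, hu, hw, rfl⟩ := hirr
      have hfu := hf u hu hu0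
      have hfw := hf w hw hw0
      rw [map_add] at hm
      exact add_mem (ih _ (by omega) u hu rfl) (ih _ (by omega) w hw rfl)
    rcases mem_sboxOf_or_exists_add_ray y S hb with hbox | ⟨j, hj, u, hu, rfl⟩
    · exact AddSubmonoid.subset_closure (Or.inr ⟨hbox, hb0, hirr⟩)
    have hj0 : y j ≠ 0 := fun h => hLI.ne_zero ⟨j, hj⟩ (castQ_eq_zero_iff.2 h)
    have hu0 : u = 0 := by
      by_contra hu0
      exact hirr ⟨y j, u, hj0, hu0, castQ_ray_mem_coneOf y hj, hu, rfl⟩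
    rw [hu0, add_zero]
    exact AddSubmonoid.subset_closure (Or.inl ⟨j, hj, rfl⟩)
end

section
/- (Lemma 4.8, algebraic kernel lemma.) Let H be a finite-dimensional commutative unital ℚ-algebra, let ∗ be a δ-deformation of the product of H on A for some δ > 0, and let x_1, …, x_M ∈ H generate H as a ℚ-algebra. Let φ̂ : ℚ[X_1,…,X_M] → H and Φ̂ : Λ^univ[X_1,…,X_M] → (A, ∗) be the algebra homomorphisms sending each X_i to x_i. Suppose w_1, …, w_m ∈ ℚ[X_1,…,X_M] generate the ideal ker φ̂, and v_1, …, v_m ∈ ker Φ̂ satisfy 𝔳_T(w_i − v_i) > 0 for all i. Then ker Φ̂ = Clos_{𝔳_T}(⟨v_1, …, v_m⟩), the closure of the ideal generated by v_1, …, v_m. -/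
/-- The Novikov finiteness condition for an `R`-valued series `f : ℝ → R`
(thought of as `∑ₖ f k · Tᵏ`): for every `c ∈ ℝ`, only finitely many exponents
`k < c` carry a nonzero coefficient.  For `R = ℚ` this carves out `Λ^univ`;
for `R = H` it carves out the module `A` of `H`-valued Novikov series. -/
def NovCondG {R : Type*} [Zero R] (f : ℝ → R) : Prop :=
  ∀ c : ℝ, {k : ℝ | k < c ∧ f k ≠ 0}.Finite

open Classical in
/-- The valuation `𝔳_T`, with `𝔳_T 0 = ∞`: the minimum of the support of a nonzero
series, viewed in `EReal`. -/
noncomputable def novValE {R : Type*} [Zero R] (f : ℝ → R) : EReal :=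
  if f = 0 then ⊤ else ((sInf {k : ℝ | f k ≠ 0} : ℝ) : EReal)

/-- The series `x · T^0` concentrated at exponent `0`; this embeds `R` into the
`R`-valued Novikov series. -/
noncomputable def constSer {R : Type*} [Zero R] (x : R) : ℝ → R :=
  fun k => if k = 0 then x else 0

/-- The `Λ^univ`-scalar action on `H`-valued series, by convolution. -/
noncomputable def convQ {H : Type*} [AddCommMonoid H] [Module ℚ H]
    (f : ℝ → ℚ) (α : ℝ → H) : ℝ → H :=
  fun k => ∑ᶠ a : ℝ, f a • α (k - a)

/-- Iterated `∗`-power of a series, with respect to a given product `st`. -/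
noncomputable def starPow {H : Type*} [CommRing H]
    (st : (ℝ → H) → (ℝ → H) → (ℝ → H)) (α : ℝ → H) : ℕ → (ℝ → H)
  | 0 => constSer 1
  | n + 1 => st α (starPow st α n)

/-- `∗`-evaluation of a monomial `mo` at the elements `x i ∈ H ⊆ A`. -/
noncomputable def monEval {H : Type*} [CommRing H] {M : ℕ}
    (st : (ℝ → H) → (ℝ → H) → (ℝ → H)) (x : Fin M → H) (mo : Fin M →₀ ℕ) : ℝ → H :=
  (List.finRange M).foldr
    (fun i acc => st (starPow st (constSer (x i)) (mo i)) acc) (constSer 1)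

/-- An element of `Λ^univ[X_1,…,X_M]`, encoded as a Novikov series with coefficients
in `ℚ[X_1,…,X_M]`: it satisfies the Novikov support condition and involves only
finitely many monomials in total. -/
def IsPolyNov {M : ℕ} (p : ℝ → MvPolynomial (Fin M) ℚ) : Prop :=
  NovCondG p ∧ (⋃ k : ℝ, ((p k).support : Set (Fin M →₀ ℕ))).Finite

/-- The evaluation homomorphism `Φ̂ : Λ^univ[X_1,…,X_M] → (A, ∗)` sending `X_i` to
`x i`, defined by `Λ^univ`-linear extension of `∗`-evaluation of monomials. -/
noncomputable def polyEval {H : Type*} [CommRing H] [Algebra ℚ H] {M : ℕ}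
    (st : (ℝ → H) → (ℝ → H) → (ℝ → H)) (x : Fin M → H)
    (p : ℝ → MvPolynomial (Fin M) ℚ) : ℝ → H :=
  fun k => ∑ᶠ a : ℝ,
    ∑ mo ∈ (p a).support, MvPolynomial.coeff mo (p a) • monEval st x mo (k - a)

/-- Multiplication in the polynomial ring `Λ^univ[X_1,…,X_M]` (convolution in the
`T`-variable, polynomial multiplication of the coefficients). -/
noncomputable def polyMul {M : ℕ} (p q : ℝ → MvPolynomial (Fin M) ℚ) :
    ℝ → MvPolynomial (Fin M) ℚ :=
  fun k => ∑ᶠ a : ℝ, p a * q (k - a)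

/-- The embedding `ℚ[X_1,…,X_M] → Λ^univ[X_1,…,X_M]`. -/
noncomputable def embedPoly {M : ℕ} (w : MvPolynomial (Fin M) ℚ) :
    ℝ → MvPolynomial (Fin M) ℚ :=
  constSer w

/-- Membership in the ideal of `Λ^univ[X_1,…,X_M]` generated by `v 1, …, v m`. -/
def InIdealGen {M m : ℕ} (v : Fin m → ℝ → MvPolynomial (Fin M) ℚ)
    (p : ℝ → MvPolynomial (Fin M) ℚ) : Prop :=
  ∃ q : Fin m → ℝ → MvPolynomial (Fin M) ℚ,
    (∀ i, IsPolyNov (q i)) ∧ p = ∑ i, polyMul (q i) (v i)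

/-- Membership in `Clos_{𝔳_T}(⟨v 1, …, v m⟩)`, the closure of the ideal generated by
the `v i`: for every `c` there is an ideal element `j` with `p = j` or
`𝔳_T (p - j) ≥ c`. -/
def CloMem {M m : ℕ} (v : Fin m → ℝ → MvPolynomial (Fin M) ℚ)
    (p : ℝ → MvPolynomial (Fin M) ℚ) : Prop :=
  ∀ c : ℝ, ∃ j : ℝ → MvPolynomial (Fin M) ℚ,
    InIdealGen v j ∧ (p = j ∨ (c : EReal) ≤ novValE (p - j))

/-- `st` is a `δ`-deformation of the product of the `ℚ`-algebra `H` on the module `A`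
of `H`-valued Novikov series: a `Λ^univ`-bilinear, associative, commutative product
with unit `1_H` such that `𝔳_T (x ∗ y - x·y) ≥ δ` for all nonzero `x, y ∈ H`. -/
def IsDeltaDeformation {H : Type*} [CommRing H] [Algebra ℚ H]
    (δ : ℝ) (st : (ℝ → H) → (ℝ → H) → (ℝ → H)) : Prop :=
  (∀ α β : ℝ → H, NovCondG α → NovCondG β → NovCondG (st α β)) ∧
  (∀ α β : ℝ → H, NovCondG α → NovCondG β → st α β = st β α) ∧
  (∀ α β γ : ℝ → H, NovCondG α → NovCondG β → NovCondG γ →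
    st (st α β) γ = st α (st β γ)) ∧
  (∀ α β γ : ℝ → H, NovCondG α → NovCondG β → NovCondG γ →
    st (α + β) γ = st α γ + st β γ) ∧
  (∀ (f : ℝ → ℚ) (α β : ℝ → H), NovCondG f → NovCondG α → NovCondG β →
    st (convQ f α) β = convQ f (st α β)) ∧
  (∀ α : ℝ → H, NovCondG α → st (constSer 1) α = α) ∧
  (∀ x y : H, x ≠ 0 → y ≠ 0 →
    (δ : EReal) ≤ novValE (st (constSer x) (constSer y) - constSer (x * y)))

/-- `VanishesBelow c f` says that the series `f` has `𝔳_T f ≥ c`. -/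
def VanishesBelow {R : Type*} [Zero R] (c : ℝ) (f : ℝ → R) : Prop :=
  ∀ k < c, f k = 0

section Series

variable {R S U : Type*}

theorem VanishesBelow.mono [Zero R] {c d : ℝ} {f : ℝ → R} (hf : VanishesBelow d f) (h : c ≤ d) :
    VanishesBelow c f :=
  fun k hk => hf k (hk.trans_le h)

theorem VanishesBelow.add [AddZeroClass R] {c : ℝ} {f g : ℝ → R} (hf : VanishesBelow c f)
    (hg : VanishesBelow c g) : VanishesBelow c (f + g) := by
  intro k hk
  simp [hf k hk, hg k hk]

theorem VanishesBelow.sum [AddCommMonoid R] {ι : Type*} {s : Finset ι} {c : ℝ} {f : ι → ℝ → R}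
    (hf : ∀ i ∈ s, VanishesBelow c (f i)) : VanishesBelow c (∑ i ∈ s, f i) := by
  intro k hk
  rw [Finset.sum_apply]
  exact Finset.sum_eq_zero fun i hi => hf i hi k hk

theorem NovCondG.exists_vanishesBelow [Zero R] {f : ℝ → R} (hf : NovCondG f) :
    ∃ l, VanishesBelow l f := by
  obtain ⟨l, hl⟩ := (hf 0).bddBelow
  refine ⟨min l 0, fun k hk => ?_⟩
  by_contra hne
  have := hl ⟨hk.trans_le (min_le_right _ _), hne⟩
  exact absurd (hk.trans_le (min_le_left _ _)) (not_lt.mpr this)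

theorem vanishesBelow_of_le_novValE [Zero R] {f : ℝ → R} (hf : NovCondG f) {c : ℝ}
    (h : (c : EReal) ≤ novValE f) : VanishesBelow c f := by
  intro k hk
  by_contra hne
  have hf0 : f ≠ 0 := fun h0 => hne (by simp [h0])
  rw [novValE, if_neg hf0, EReal.coe_le_coe_iff] at h
  obtain ⟨l, hl⟩ := hf.exists_vanishesBelow
  have hbdd : BddBelow {k : ℝ | f k ≠ 0} := ⟨l, fun a ha => not_lt.mp fun hlt => ha (hl a hlt)⟩
  exact absurd (h.trans (csInf_le hbdd hne)) (not_le.mpr hk)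

theorem VanishesBelow.le_novValE [Zero R] {f : ℝ → R} {c : ℝ} (h : VanishesBelow c f) :
    (c : EReal) ≤ novValE f := by
  rw [novValE]
  split_ifs with hf0
  · exact le_top
  · rw [EReal.coe_le_coe_iff]
    obtain ⟨k, hk⟩ := Function.ne_iff.mp hf0
    exact le_csInf ⟨k, hk⟩ fun a ha => not_lt.mp fun hlt => ha (h a hlt)

theorem exists_pos_vanishesBelow [Zero R] {f : ℝ → R} (hf : NovCondG f) (h : 0 < novValE f) :
    ∃ ε > 0, VanishesBelow ε f := by
  obtain ⟨ε, h0, hε⟩ := EReal.lt_iff_exists_real_btwn.mp h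
  exact ⟨ε, by exact_mod_cast h0, vanishesBelow_of_le_novValE hf hε.le⟩

theorem NovCondG.of_support [Zero R] [Zero S] {f : ℝ → R} {g : ℝ → S} (hf : NovCondG f)
    (h : ∀ k, g k ≠ 0 → f k ≠ 0) : NovCondG g :=
  fun c => (hf c).subset fun k hk => ⟨hk.1, h k hk.2⟩

theorem novCondG_zero [Zero R] : NovCondG (0 : ℝ → R) := by
  intro c
  simp

theorem NovCondG.add [AddZeroClass R] {f g : ℝ → R} (hf : NovCondG f) (hg : NovCondG g) :
    NovCondG (f + g) := by
  refine fun c => ((hf c).union (hg c)).subset ?_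
  rintro k ⟨hk, hne⟩
  by_cases h : f k = 0
  · exact Or.inr ⟨hk, fun h' => hne (by simp [h, h'])⟩
  · exact Or.inl ⟨hk, h⟩

theorem NovCondG.sub [AddGroup R] {f g : ℝ → R} (hf : NovCondG f) (hg : NovCondG g) :
    NovCondG (f - g) := by
  rw [sub_eq_add_neg]
  exact hf.add (hg.of_support fun k hk => by simpa using hk)

theorem NovCondG.sum [AddCommMonoid R] {ι : Type*} {s : Finset ι} {f : ι → ℝ → R}
    (hf : ∀ i ∈ s, NovCondG (f i)) : NovCondG (∑ i ∈ s, f i) :=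
  Finset.sum_induction f NovCondG (fun _ _ => NovCondG.add) novCondG_zero hf

theorem novCondG_constSer [Zero R] (x : R) : NovCondG (constSer x) := by
  refine fun c => (Set.finite_singleton (0 : ℝ)).subset ?_
  rintro k ⟨-, hk⟩
  by_contra hne
  exact hk (if_neg hne)

theorem vanishesBelow_constSer [Zero R] (x : R) : VanishesBelow 0 (constSer x) :=
  fun _ hk => if_neg hk.ne

theorem constSer_add [AddZeroClass R] (x y : R) :
    constSer (x + y) = constSer x + constSer y := by
  funext k
  by_cases hk : k = 0 <;> simp [constSer, hk]

theorem finite_support_of_novCondG [Zero R] [Zero U] {f : ℝ → R} (hf : NovCondG f) {F : ℝ → U}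
    {c : ℝ} (h : ∀ a, F a ≠ 0 → a < c ∧ f a ≠ 0) : F.support.Finite :=
  (hf c).subset h

theorem finite_support_conv [Zero R] [Zero S] [Zero U] {f : ℝ → R} {g : ℝ → S}
    (hf : NovCondG f) (hg : NovCondG g) {k : ℝ} {F : ℝ → U}
    (h : ∀ a, F a ≠ 0 → f a ≠ 0 ∧ g (k - a) ≠ 0) : F.support.Finite := by
  obtain ⟨l, hl⟩ := hg.exists_vanishesBelow
  refine finite_support_of_novCondG hf (c := k - l + 1) fun a ha => ⟨?_, (h a ha).1⟩
  have := not_lt.mp fun hlt => (h a ha).2 (hl _ hlt)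
  linarith

theorem NovCondG.conv [Zero R] [Zero S] [Zero U] {f : ℝ → R} {g : ℝ → S} {F : ℝ → U}
    (hf : NovCondG f) (hg : NovCondG g)
    (h : ∀ k, F k ≠ 0 → ∃ a, f a ≠ 0 ∧ g (k - a) ≠ 0) : NovCondG F := by
  obtain ⟨l, hl⟩ := hf.exists_vanishesBelow
  obtain ⟨l', hl'⟩ := hg.exists_vanishesBelow
  intro c
  refine (((hf (c - l')).prod (hg (c - l))).image fun z => z.1 + z.2).subset ?_
  rintro k ⟨hk, hne⟩
  obtain ⟨a, ha, hb⟩ := h k hne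
  have h1 := not_lt.mp fun hlt => ha (hl _ hlt)
  have h2 := not_lt.mp fun hlt => hb (hl' _ hlt)
  exact ⟨(a, k - a), ⟨⟨by linarith, ha⟩, ⟨by linarith, hb⟩⟩, by simp⟩

theorem VanishesBelow.conv [Zero R] [Zero S] [Zero U] {f : ℝ → R} {g : ℝ → S} {F : ℝ → U}
    {c d : ℝ} (hf : VanishesBelow c f) (hg : VanishesBelow d g)
    (h : ∀ k, F k ≠ 0 → ∃ a, f a ≠ 0 ∧ g (k - a) ≠ 0) : VanishesBelow (c + d) F := by
  intro k hk
  by_contra hne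
  obtain ⟨a, ha, hb⟩ := h k hne
  have h1 := not_lt.mp fun hlt => ha (hf _ hlt)
  have h2 := not_lt.mp fun hlt => hb (hg _ hlt)
  linarith

end Series

theorem exists_ne_zero_of_finsum_ne_zero {ι U : Type*} [AddCommMonoid U] {F : ι → U}
    (h : ∑ᶠ a, F a ≠ 0) : ∃ a, F a ≠ 0 := by
  by_contra! h0
  exact h (finsum_eq_zero_of_forall_eq_zero h0)

section ScalarAction

variable {H : Type*} [AddCommGroup H] [Module ℚ H]

theorem exists_of_convQ_ne_zero (f : ℝ → ℚ) (α : ℝ → H) (k : ℝ) (h : convQ f α k ≠ 0) :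
    ∃ a, f a ≠ 0 ∧ α (k - a) ≠ 0 := by
  obtain ⟨a, ha⟩ := exists_ne_zero_of_finsum_ne_zero h
  exact ⟨a, left_ne_zero_of_smul ha, right_ne_zero_of_smul ha⟩

theorem NovCondG.convQ {f : ℝ → ℚ} {α : ℝ → H} (hf : NovCondG f) (hα : NovCondG α) :
    NovCondG (convQ f α) :=
  hf.conv hα (exists_of_convQ_ne_zero f α)

theorem VanishesBelow.convQ {f : ℝ → ℚ} {α : ℝ → H} {c d : ℝ} (hf : VanishesBelow c f)
    (hα : VanishesBelow d α) : VanishesBelow (c + d) (convQ f α) :=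
  hf.conv hα (exists_of_convQ_ne_zero f α)

theorem convQ_constSer_left (q : ℚ) (α : ℝ → H) : convQ (constSer q) α = q • α := by
  funext k
  rw [convQ, finsum_eq_single _ 0 fun a ha => by simp [constSer, ha]]
  simp [constSer]

theorem convQ_constSer_right (f : ℝ → ℚ) (y : H) : convQ f (constSer y) = fun k => f k • y := by
  funext k
  rw [convQ, finsum_eq_single _ k fun a ha => by
    simp [constSer, sub_eq_zero, ha.symm]]
  simp [constSer]

end ScalarAction

/-- The Novikov series with values in `H`, to be equipped with a deformed product. -/
@[ext]
structure DeformedAlgebra {H : Type*} [CommRing H] [Algebra ℚ H] {δ : ℝ}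
    {st : (ℝ → H) → (ℝ → H) → (ℝ → H)} (hst : IsDeltaDeformation δ st) where
  /-- The underlying series. -/
  val : ℝ → H
  property : NovCondG val

namespace DeformedAlgebra

variable {H : Type*} [CommRing H] [Algebra ℚ H] {δ : ℝ}
  {st : (ℝ → H) → (ℝ → H) → (ℝ → H)} (hst : IsDeltaDeformation δ st)

instance : Zero (DeformedAlgebra hst) := ⟨⟨0, novCondG_zero⟩⟩

instance : Add (DeformedAlgebra hst) := ⟨fun a b => ⟨a.1 + b.1, a.2.add b.2⟩⟩

instance : Neg (DeformedAlgebra hst) :=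
  ⟨fun a => ⟨-a.1, a.2.of_support fun _ hk => neg_ne_zero.mp hk⟩⟩

instance : Sub (DeformedAlgebra hst) := ⟨fun a b => ⟨a.1 - b.1, a.2.sub b.2⟩⟩

instance {K : Type*} [SMulZeroClass K H] : SMul K (DeformedAlgebra hst) :=
  ⟨fun q a => ⟨q • a.1, a.2.of_support fun k hk h0 => hk (by simp [h0])⟩⟩

theorem val_injective : Function.Injective (val : DeformedAlgebra hst → ℝ → H) :=
  fun _ _ => DeformedAlgebra.ext

instance : AddCommGroup (DeformedAlgebra hst) :=
  (val_injective hst).addCommGroup val rfl (fun _ _ => rfl) (fun _ => rfl) (fun _ _ => rfl)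
    (fun _ _ => rfl) fun _ _ => rfl

noncomputable instance : CommRing (DeformedAlgebra hst) :=
  { (inferInstance : AddCommGroup (DeformedAlgebra hst)) with
    mul := fun a b => ⟨st a.1 b.1, hst.1 _ _ a.2 b.2⟩
    one := ⟨constSer 1, novCondG_constSer 1⟩
    mul_comm := fun a b => DeformedAlgebra.ext (hst.2.1 _ _ a.2 b.2)
    mul_assoc := fun a b c => DeformedAlgebra.ext (hst.2.2.1 _ _ _ a.2 b.2 c.2)
    right_distrib := fun a b c => DeformedAlgebra.ext (hst.2.2.2.1 _ _ _ a.2 b.2 c.2)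
    left_distrib := fun a b c => DeformedAlgebra.ext <|
      (hst.2.1 _ _ a.2 (NovCondG.add b.2 c.2)).trans <|
        (hst.2.2.2.1 _ _ _ b.2 c.2 a.2).trans <|
          congrArg₂ (· + ·) (hst.2.1 _ _ b.2 a.2) (hst.2.1 _ _ c.2 a.2)
    one_mul := fun a => DeformedAlgebra.ext (hst.2.2.2.2.2.1 _ a.2)
    mul_one := fun a => DeformedAlgebra.ext <|
      (hst.2.1 _ _ a.2 (novCondG_constSer 1)).trans (hst.2.2.2.2.2.1 _ a.2)
    zero_mul := fun a => DeformedAlgebra.ext <| by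
      have h := hst.2.2.2.1 0 0 a.1 novCondG_zero novCondG_zero a.2
      rw [add_zero] at h
      exact left_eq_add.mp h
    mul_zero := fun a => DeformedAlgebra.ext <| by
      have h := hst.2.2.2.1 0 0 a.1 novCondG_zero novCondG_zero a.2
      rw [add_zero] at h
      exact (hst.2.1 _ _ a.2 novCondG_zero).trans (left_eq_add.mp h) }

/-- Taking the underlying series, as an additive map. -/
def valAddHom : DeformedAlgebra hst →+ (ℝ → H) where
  toFun := val
  map_zero' := rfl
  map_add' _ _ := rfl

noncomputable instance : Module ℚ (DeformedAlgebra hst) :=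
  (val_injective hst).module ℚ (valAddHom hst) fun _ _ => rfl

variable {hst}

/-- The action of a scalar Novikov series on the deformed algebra. -/
noncomputable def scale (f : ℝ → ℚ) (hf : NovCondG f) (a : DeformedAlgebra hst) :
    DeformedAlgebra hst :=
  ⟨convQ f a.1, hf.convQ a.2⟩

theorem scale_mul (f : ℝ → ℚ) (hf : NovCondG f) (a b : DeformedAlgebra hst) :
    scale f hf a * b = scale f hf (a * b) :=
  DeformedAlgebra.ext (hst.2.2.2.2.1 f _ _ hf a.2 b.2)

theorem smul_eq_scale (q : ℚ) (a : DeformedAlgebra hst) :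
    q • a = scale (constSer q) (novCondG_constSer q) a :=
  DeformedAlgebra.ext (convQ_constSer_left q a.1).symm

noncomputable instance : Algebra ℚ (DeformedAlgebra hst) :=
  Algebra.ofModule (fun q a b => by rw [smul_eq_scale, smul_eq_scale, scale_mul])
    (fun q a b => by
      rw [smul_eq_scale, smul_eq_scale, mul_comm, scale_mul, mul_comm])

variable (hst) in
/-- The element of the deformed algebra concentrated at exponent `0`. -/
noncomputable def const (y : H) : DeformedAlgebra hst :=
  ⟨constSer y, novCondG_constSer y⟩

variable (hst) in
theorem const_add (y z : H) : const hst (y + z) = const hst y + const hst z :=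
  DeformedAlgebra.ext (constSer_add y z)

theorem coe_sum {ι : Type*} (s : Finset ι) (a : ι → DeformedAlgebra hst) :
    (∑ i ∈ s, a i).1 = ∑ i ∈ s, (a i).1 :=
  map_sum (valAddHom hst) a s

theorem eq_sum_scale_basis {ι : Type*} [Fintype ι] (b : Module.Basis ι ℚ H)
    (a : DeformedAlgebra hst) :
    a = ∑ i, scale (fun k => b.repr (a.1 k) i)
      (NovCondG.of_support a.2 fun k hk h0 => hk (by simp [h0])) (const hst (b i)) := by
  apply DeformedAlgebra.ext
  rw [coe_sum]
  funext k
  rw [Finset.sum_apply]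
  conv_lhs => rw [← b.sum_repr (a.1 k)]
  refine Finset.sum_congr rfl fun i _ => ?_
  exact (congrFun (convQ_constSer_right (fun k => b.repr (a.1 k) i) (b i)) k).symm

theorem vanishesBelow_const_mul_const_sub (y z : H) :
    VanishesBelow δ (const hst y * const hst z - const hst (y * z)).1 := by
  by_cases hy : y = 0
  · have h0 : const hst (0 : H) = 0 := DeformedAlgebra.ext (by funext k; simp [const, constSer]; rfl)
    subst hy
    rw [zero_mul, h0, zero_mul, sub_zero]
    exact fun k _ => rfl
  by_cases hz : z = 0
  · have h0 : const hst (0 : H) = 0 := DeformedAlgebra.ext (by funext k; simp [const, constSer]; rfl)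
    subst hz
    rw [mul_zero, h0, mul_zero, sub_zero]
    exact fun k _ => rfl
  exact vanishesBelow_of_le_novValE (const hst y * const hst z - const hst (y * z)).2
    (hst.2.2.2.2.2.2 y z hy hz)

theorem vanishesBelow_const_mul_const (hδ : 0 < δ) (y z : H) :
    VanishesBelow 0 (const hst y * const hst z).1 := by
  have h := ((vanishesBelow_const_mul_const_sub (hst := hst) y z).mono hδ.le).add
    (vanishesBelow_constSer (y * z))
  have e : (const hst y * const hst z).1 =
      (const hst y * const hst z - const hst (y * z)).1 + constSer (y * z) :=
    congrArg val (sub_add_cancel (const hst y * const hst z) (const hst (y * z))).symm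
  rwa [e]

theorem vanishesBelow_mul [FiniteDimensional ℚ H] (hδ : 0 < δ) {a b : DeformedAlgebra hst}
    {c d : ℝ} (ha : VanishesBelow c a.1) (hb : VanishesBelow d b.1) :
    VanishesBelow (c + d) (a * b).1 := by
  have key : ∀ (y : H) (b : DeformedAlgebra hst) (d : ℝ), VanishesBelow d b.1 →
      (∀ z, VanishesBelow 0 (const hst z * const hst y).1) →
      VanishesBelow d (b * const hst y).1 := by
    intro y b d hb h
    rw [eq_sum_scale_basis (Module.finBasis ℚ H) b, Finset.sum_mul, coe_sum]
    refine VanishesBelow.sum fun i _ => ?_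
    rw [scale_mul, ← add_zero d]
    exact VanishesBelow.convQ (fun k hk => by simp [hb k hk]) (h _)
  rw [eq_sum_scale_basis (Module.finBasis ℚ H) a, Finset.sum_mul, coe_sum]
  refine VanishesBelow.sum fun i _ => ?_
  rw [scale_mul, mul_comm]
  exact VanishesBelow.convQ (fun k hk => by simp [ha k hk])
    (key _ _ _ hb fun z => vanishesBelow_const_mul_const hδ _ _)

variable {M : ℕ}

variable (hst) in
/-- The deformed evaluation of polynomials with rational coefficients. -/
noncomputable def eval (x : Fin M → H) : MvPolynomial (Fin M) ℚ →ₐ[ℚ] DeformedAlgebra hst :=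
  MvPolynomial.aeval fun i => const hst (x i)

theorem starPow_eq_pow (y : H) (n : ℕ) : starPow st (constSer y) n = (const hst y ^ n).1 := by
  induction n with
  | zero => rw [pow_zero]; rfl
  | succ n ih =>
    rw [starPow, ih, pow_succ']
    rfl

theorem monEval_eq_eval (x : Fin M → H) (mo : Fin M →₀ ℕ) :
    monEval st x mo = (eval hst x (MvPolynomial.monomial mo 1)).1 := by
  have h : ∀ l : List (Fin M),
      l.foldr (fun i acc => st (starPow st (constSer (x i)) (mo i)) acc) (constSer 1) =
        ((l.map fun i => const hst (x i) ^ mo i).prod).1 := by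
    intro l
    induction l with
    | nil => rfl
    | cons i l ih =>
      rw [List.foldr_cons, ih, starPow_eq_pow (hst := hst), List.map_cons, List.prod_cons]
      rfl
  rw [monEval, h, eval, MvPolynomial.aeval_monomial, map_one, one_mul,
    Finsupp.prod_fintype _ _ fun i => pow_zero _, Fin.prod_univ_def]

theorem polyEval_eq_finsum (x : Fin M → H) (p : ℝ → MvPolynomial (Fin M) ℚ) (k : ℝ) :
    polyEval st x p k = ∑ᶠ a, (eval hst x (p a)).1 (k - a) := by
  refine finsum_congr fun a => ?_
  conv_rhs => rw [(p a).as_sum, map_sum, coe_sum, Finset.sum_apply]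
  refine Finset.sum_congr rfl fun mo _ => ?_
  rw [monEval_eq_eval (hst := hst), ← mul_one (MvPolynomial.coeff mo (p a)),
    ← smul_eq_mul, ← MvPolynomial.smul_monomial, map_smul, smul_eq_mul, mul_one]
  rfl

theorem vanishesBelow_eval_sub [FiniteDimensional ℚ H] (hδ : 0 < δ) (x : Fin M → H)
    (u : MvPolynomial (Fin M) ℚ) :
    VanishesBelow δ (eval hst x u - const hst (MvPolynomial.aeval x u)).1 := by
  induction u using MvPolynomial.induction_on with
  | C q =>
    have h : eval hst x (MvPolynomial.C q) =
        const hst (MvPolynomial.aeval x (MvPolynomial.C q)) := by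
      rw [eval, MvPolynomial.aeval_C, MvPolynomial.aeval_C, Algebra.algebraMap_eq_smul_one,
        Algebra.algebraMap_eq_smul_one]
      apply DeformedAlgebra.ext
      funext k
      change q • constSer (1 : H) k = constSer (q • (1 : H)) k
      by_cases hk : k = 0 <;> simp [constSer, hk]
    rw [h, sub_self]
    exact fun k _ => rfl
  | add u u' hu hu' =>
    rw [map_add, map_add, const_add, add_sub_add_comm]
    exact hu.add hu'
  | mul_X u i hu =>
    have h : eval hst x (u * MvPolynomial.X i) -
          const hst (MvPolynomial.aeval x (u * MvPolynomial.X i)) =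
        (eval hst x u - const hst (MvPolynomial.aeval x u)) * const hst (x i) +
          (const hst (MvPolynomial.aeval x u) * const hst (x i) -
            const hst (MvPolynomial.aeval x u * x i)) := by
      rw [map_mul, map_mul, MvPolynomial.aeval_X, eval, MvPolynomial.aeval_X]
      ring
    rw [h]
    have h1 := vanishesBelow_mul (b := const hst (x i)) hδ hu (vanishesBelow_constSer (x i))
    rw [add_zero] at h1
    exact h1.add (vanishesBelow_const_mul_const_sub _ _)

theorem eval_apply_of_lt [FiniteDimensional ℚ H] (hδ : 0 < δ) (x : Fin M → H)
    (u : MvPolynomial (Fin M) ℚ) {s : ℝ} (hs : s < δ) :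
    (eval hst x u).1 s = constSer (MvPolynomial.aeval x u) s :=
  sub_eq_zero.mp (vanishesBelow_eval_sub (hst := hst) hδ x u s hs)

theorem vanishesBelow_eval [FiniteDimensional ℚ H] (hδ : 0 < δ) (x : Fin M → H)
    (u : MvPolynomial (Fin M) ℚ) : VanishesBelow 0 (eval hst x u).1 := by
  intro s hs
  rw [eval_apply_of_lt hδ x u (hs.trans hδ), vanishesBelow_constSer _ s hs]

theorem finite_support_eval [FiniteDimensional ℚ H] (hδ : 0 < δ) (x : Fin M → H)
    {p : ℝ → MvPolynomial (Fin M) ℚ} (hp : NovCondG p) (u : MvPolynomial (Fin M) ℚ) (k : ℝ) :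
    (Function.support fun a => (eval hst x (u * p a)).1 (k - a)).Finite := by
  refine finite_support_of_novCondG hp (c := k + 1) fun a ha => ⟨?_, fun h0 => ha ?_⟩
  · have := not_lt.mp fun hlt => ha (vanishesBelow_eval hδ x _ (k - a) hlt)
    linarith
  · simp only [h0, mul_zero, map_zero]
    rfl

/-- Multiplying an element of the kernel of the deformed evaluation by a polynomial with
rational coefficients gives an element of the kernel. -/
theorem finsum_eval_mul_eq_zero (x : Fin M → H) {v : ℝ → MvPolynomial (Fin M) ℚ}
    (hv : IsPolyNov v) (hker : polyEval st x v = 0) (u : MvPolynomial (Fin M) ℚ) (k : ℝ) :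
    ∑ᶠ a, (eval hst x (u * v a)).1 (k - a) = 0 := by
  set S := hv.2.toFinset
  have hc : ∀ mo, NovCondG fun a => MvPolynomial.coeff mo (v a) := fun mo =>
    hv.1.of_support fun a ha h0 => ha (by simp [h0])
  have expand : ∀ u : MvPolynomial (Fin M) ℚ, ∀ k,
      ∑ᶠ a, (eval hst x (u * v a)).1 (k - a) =
        (∑ mo ∈ S, scale _ (hc mo) (eval hst x (u * MvPolynomial.monomial mo 1))).1 k := by
    intro u k
    rw [coe_sum, Finset.sum_apply]
    refine Eq.trans (finsum_congr fun a => ?_) (finsum_sum_comm S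
      (fun a mo => MvPolynomial.coeff mo (v a) •
        (eval hst x (u * MvPolynomial.monomial mo 1)).1 (k - a)) fun mo _ =>
          finite_support_conv (hc mo) (eval hst x (u * MvPolynomial.monomial mo 1)).2
            fun a ha => ⟨left_ne_zero_of_smul ha, right_ne_zero_of_smul ha⟩)
    have hva : v a = ∑ mo ∈ S, MvPolynomial.coeff mo (v a) • MvPolynomial.monomial mo (1 : ℚ) := by
      conv_lhs => rw [(v a).as_sum]
      refine (Finset.sum_subset (fun mo hmo => ?_) fun mo _ hmo => ?_).trans
        (Finset.sum_congr rfl fun mo _ => ?_)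
      · exact hv.2.mem_toFinset.mpr (Set.mem_iUnion.mpr ⟨a, hmo⟩)
      · rw [MvPolynomial.notMem_support_iff.mp hmo, map_zero]
      · rw [MvPolynomial.smul_monomial, smul_eq_mul, mul_one]
    conv_lhs => rw [hva, Finset.mul_sum, map_sum, coe_sum, Finset.sum_apply]
    refine Finset.sum_congr rfl fun mo _ => ?_
    rw [mul_smul_comm, map_smul]
    rfl
  have hone : ∑ mo ∈ S, scale _ (hc mo) (eval hst x (1 * MvPolynomial.monomial mo 1)) = 0 := by
    apply DeformedAlgebra.ext
    funext k
    rw [← expand]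
    simp only [one_mul]
    rw [← polyEval_eq_finsum, hker]
    rfl
  rw [expand]
  have : ∑ mo ∈ S, scale _ (hc mo) (eval hst x (u * MvPolynomial.monomial mo 1)) =
      (∑ mo ∈ S, scale _ (hc mo) (eval hst x (1 * MvPolynomial.monomial mo 1))) *
        eval hst x u := by
    rw [Finset.sum_mul]
    refine Finset.sum_congr rfl fun mo _ => ?_
    rw [scale_mul, one_mul, mul_comm u, map_mul]
  rw [this, hone, zero_mul]
  rfl

end DeformedAlgebra

section PolyMul

variable {M m : ℕ}

theorem exists_of_polyMul_ne_zero (p q : ℝ → MvPolynomial (Fin M) ℚ) (k : ℝ)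
    (h : polyMul p q k ≠ 0) : ∃ a, p a ≠ 0 ∧ q (k - a) ≠ 0 := by
  obtain ⟨a, ha⟩ := exists_ne_zero_of_finsum_ne_zero h
  exact ⟨a, left_ne_zero_of_mul ha, right_ne_zero_of_mul ha⟩

theorem finite_support_mul {p q : ℝ → MvPolynomial (Fin M) ℚ} (hp : NovCondG p)
    (hq : NovCondG q) (k : ℝ) : (Function.support fun a => p a * q (k - a)).Finite :=
  finite_support_conv hp hq fun _ ha => ⟨left_ne_zero_of_mul ha, right_ne_zero_of_mul ha⟩

theorem NovCondG.polyMul {p q : ℝ → MvPolynomial (Fin M) ℚ} (hp : NovCondG p)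
    (hq : NovCondG q) : NovCondG (polyMul p q) :=
  hp.conv hq (exists_of_polyMul_ne_zero p q)

theorem polyMul_add_left {p p' q : ℝ → MvPolynomial (Fin M) ℚ} (hp : NovCondG p)
    (hp' : NovCondG p') (hq : NovCondG q) :
    polyMul (p + p') q = polyMul p q + polyMul p' q := by
  funext k
  simp only [polyMul, Pi.add_apply, add_mul]
  exact finsum_add_distrib (finite_support_mul hp hq k) (finite_support_mul hp' hq k)

theorem polyMul_sub_right {p q q' : ℝ → MvPolynomial (Fin M) ℚ} (hp : NovCondG p)
    (hq : NovCondG q) (hq' : NovCondG q') :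
    polyMul p (q - q') = polyMul p q - polyMul p q' := by
  funext k
  simp only [polyMul, Pi.sub_apply, mul_sub]
  exact finsum_sub_distrib (finite_support_mul hp hq k) (finite_support_mul hp hq' k)

theorem polyMul_embedPoly (p : ℝ → MvPolynomial (Fin M) ℚ) (u : MvPolynomial (Fin M) ℚ)
    (k : ℝ) : polyMul p (embedPoly u) k = p k * u := by
  rw [polyMul, finsum_eq_single _ k fun a ha => by
    simp [embedPoly, constSer, sub_eq_zero, ha.symm]]
  simp [embedPoly, constSer]

theorem IsPolyNov.add {p q : ℝ → MvPolynomial (Fin M) ℚ} (hp : IsPolyNov p)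
    (hq : IsPolyNov q) : IsPolyNov (p + q) := by
  refine ⟨hp.1.add hq.1, (hp.2.union hq.2).subset ?_⟩
  refine Set.iUnion_subset fun k mo hmo => ?_
  rcases Finset.mem_union.mp (MvPolynomial.support_add hmo) with h | h
  · exact Or.inl (Set.mem_iUnion.mpr ⟨k, h⟩)
  · exact Or.inr (Set.mem_iUnion.mpr ⟨k, h⟩)

theorem isPolyNov_of_finite_support {p : ℝ → MvPolynomial (Fin M) ℚ}
    (hp : p.support.Finite) : IsPolyNov p := by
  refine ⟨fun c => hp.subset fun k hk => hk.2,
    (hp.biUnion fun k _ => (p k).support.finite_toSet).subset ?_⟩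
  refine Set.iUnion_subset fun k mo hmo => Set.mem_biUnion (x := k) ?_ hmo
  intro h0
  simp [h0] at hmo

theorem inIdealGen_zero (v : Fin m → ℝ → MvPolynomial (Fin M) ℚ) : InIdealGen v 0 := by
  refine ⟨0, fun i => isPolyNov_of_finite_support (by simp), ?_⟩
  funext k
  simp [polyMul]

theorem InIdealGen.add {v : Fin m → ℝ → MvPolynomial (Fin M) ℚ} (hv : ∀ i, IsPolyNov (v i))
    {p p' : ℝ → MvPolynomial (Fin M) ℚ} (hp : InIdealGen v p) (hp' : InIdealGen v p') :
    InIdealGen v (p + p') := by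
  obtain ⟨q, hq, rfl⟩ := hp
  obtain ⟨q', hq', rfl⟩ := hp'
  refine ⟨q + q', fun i => (hq i).add (hq' i), ?_⟩
  rw [← Finset.sum_add_distrib]
  exact Finset.sum_congr rfl fun i _ => (polyMul_add_left (hq i).1 (hq' i).1 (hv i).1).symm

theorem InIdealGen.novCondG {v : Fin m → ℝ → MvPolynomial (Fin M) ℚ}
    (hv : ∀ i, IsPolyNov (v i)) {p : ℝ → MvPolynomial (Fin M) ℚ} (hp : InIdealGen v p) :
    NovCondG p := by
  obtain ⟨q, hq, rfl⟩ := hp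
  exact NovCondG.sum fun i _ => (hq i).1.polyMul (hv i).1

end PolyMul

section Evaluation

open DeformedAlgebra

variable {H : Type*} [CommRing H] [Algebra ℚ H] [FiniteDimensional ℚ H] {M m : ℕ} {δ : ℝ}
  {st : (ℝ → H) → (ℝ → H) → (ℝ → H)}

theorem polyEval_add (hst : IsDeltaDeformation δ st) (hδ : 0 < δ) (x : Fin M → H)
    {p q : ℝ → MvPolynomial (Fin M) ℚ} (hp : NovCondG p) (hq : NovCondG q) :
    polyEval st x (p + q) = polyEval st x p + polyEval st x q := by
  funext k
  have hp' := finite_support_eval (hst := hst) hδ x hp 1 k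
  have hq' := finite_support_eval (hst := hst) hδ x hq 1 k
  simp only [one_mul] at hp' hq'
  rw [Pi.add_apply, polyEval_eq_finsum (hst := hst), polyEval_eq_finsum (hst := hst),
    polyEval_eq_finsum (hst := hst), ← finsum_add_distrib hp' hq']
  refine finsum_congr fun a => ?_
  rw [Pi.add_apply, map_add]
  rfl

theorem VanishesBelow.polyEval (hst : IsDeltaDeformation δ st) (hδ : 0 < δ) (x : Fin M → H)
    {p : ℝ → MvPolynomial (Fin M) ℚ} {c : ℝ} (hp : VanishesBelow c p) :
    VanishesBelow c (polyEval st x p) := by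
  intro k hk
  rw [polyEval_eq_finsum (hst := hst)]
  refine finsum_eq_zero_of_forall_eq_zero fun a => ?_
  by_cases ha : a < c
  · rw [hp a ha, map_zero]
    rfl
  · exact vanishesBelow_eval hδ x _ _ (by linarith)

theorem polyEval_polyMul_eq_zero (hst : IsDeltaDeformation δ st) (hδ : 0 < δ) (x : Fin M → H)
    {q v : ℝ → MvPolynomial (Fin M) ℚ} (hq : NovCondG q) (hv : IsPolyNov v)
    (hker : polyEval st x v = 0) : polyEval st x (polyMul q v) = 0 := by
  funext k
  obtain ⟨l, hl⟩ := hv.1.exists_vanishesBelow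
  set B := (hq (k - l + 1)).toFinset
  have hshift : ∀ b, (fun a => (eval hst x (q b * v (a - b))).1 (k - a)) =
      (fun a => (eval hst x (q b * v a)).1 (k - b - a)) ∘ Equiv.subRight b := by
    intro b
    funext a
    simp
  have hterm : ∀ a, (eval hst x (polyMul q v a)).1 (k - a) =
      ∑ b ∈ B, (eval hst x (q b * v (a - b))).1 (k - a) := by
    intro a
    by_cases ha : k < a
    · rw [vanishesBelow_eval hδ x _ _ (by linarith),
        Finset.sum_eq_zero fun b _ => vanishesBelow_eval hδ x _ _ (by linarith)]
    · have : polyMul q v a = ∑ b ∈ B, q b * v (a - b) := by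
        refine finsum_eq_sum_of_support_subset _ fun b hb => ?_
        have h1 := not_lt.mp fun hlt => right_ne_zero_of_mul hb (hl _ hlt)
        exact (Set.Finite.mem_toFinset _).mpr ⟨by linarith, left_ne_zero_of_mul hb⟩
      rw [this, map_sum, coe_sum, Finset.sum_apply]
  rw [polyEval_eq_finsum (hst := hst), finsum_congr hterm, finsum_sum_comm]
  · refine Finset.sum_eq_zero fun b _ => ?_
    rw [hshift]
    exact (finsum_comp_equiv (Equiv.subRight b)).trans
      (finsum_eval_mul_eq_zero x hv hker (q b) (k - b))
  · intro b _
    rw [hshift]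
    exact (finite_support_eval hδ x hv.1 (q b) (k - b)).preimage
      (Equiv.subRight b).injective.injOn

theorem InIdealGen.polyEval_eq_zero (hst : IsDeltaDeformation δ st) (hδ : 0 < δ)
    (x : Fin M → H) {v : Fin m → ℝ → MvPolynomial (Fin M) ℚ} (hv : ∀ i, IsPolyNov (v i))
    (hker : ∀ i, polyEval st x (v i) = 0) {p : ℝ → MvPolynomial (Fin M) ℚ}
    (hp : InIdealGen v p) : polyEval st x p = 0 := by
  obtain ⟨q, hq, rfl⟩ := hp
  refine (Finset.sum_induction (fun i => polyMul (q i) (v i))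
    (fun r => NovCondG r ∧ polyEval st x r = 0) ?_ ?_ fun i _ =>
      ⟨(hq i).1.polyMul (hv i).1,
        polyEval_polyMul_eq_zero hst hδ x (hq i).1 (hv i) (hker i)⟩).2
  · rintro r r' ⟨hr, h0⟩ ⟨hr', h0'⟩
    exact ⟨hr.add hr', by rw [polyEval_add hst hδ x hr hr', h0, h0', add_zero]⟩
  · refine ⟨novCondG_zero, ?_⟩
    funext k
    simp [polyEval]

/-- If the deformed evaluation of `p` vanishes, then the coefficients of `p` at exponents
less than `δ` above the valuation of `p` lie in the kernel of the undeformed evaluation. -/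
theorem aeval_eq_zero_of_polyEval_eq_zero (hst : IsDeltaDeformation δ st) (hδ : 0 < δ)
    (x : Fin M → H) {p : ℝ → MvPolynomial (Fin M) ℚ} {l : ℝ} (hl : VanishesBelow l p)
    (hker : polyEval st x p = 0) {k : ℝ} (hk : k < l + δ) :
    MvPolynomial.aeval x (p k) = 0 := by
  have h := congrFun hker k
  rw [polyEval_eq_finsum (hst := hst), finsum_eq_single _ k, sub_self,
    eval_apply_of_lt hδ x _ hδ] at h
  · simpa [constSer] using h
  · intro a ha
    by_cases hal : a < l
    · rw [hl a hal, map_zero]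
      rfl
    · rw [eval_apply_of_lt hδ x _ (by linarith)]
      exact if_neg (sub_ne_zero.mpr ha.symm)

/-- Subtracting a suitable element of the ideal raises the valuation of an element of the
kernel by a fixed amount. -/
theorem exists_inIdealGen_vanishesBelow_sub (hst : IsDeltaDeformation δ st) (hδ : 0 < δ)
    (x : Fin M → H) {w : Fin m → MvPolynomial (Fin M) ℚ}
    (hw : ∀ p, MvPolynomial.aeval x p = 0 → p ∈ Ideal.span (Set.range w))
    {v : Fin m → ℝ → MvPolynomial (Fin M) ℚ} (hv : ∀ i, IsPolyNov (v i))
    {ε : ℝ} (hεδ : ε ≤ δ) (hε : ∀ i, VanishesBelow ε (embedPoly (w i) - v i))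
    {p : ℝ → MvPolynomial (Fin M) ℚ} (hp : NovCondG p) {l : ℝ} (hl : VanishesBelow l p)
    (hker : polyEval st x p = 0) :
    ∃ j, InIdealGen v j ∧ VanishesBelow (l + ε) (p - j) := by
  have hcoef : ∀ k, ∃ c : Fin m → MvPolynomial (Fin M) ℚ,
      (k < l + ε → ∑ i, c i * w i = p k) ∧ (¬(k < l + ε ∧ p k ≠ 0) → c = 0) := by
    intro k
    by_cases hk : k < l + ε ∧ p k ≠ 0
    · obtain ⟨c, hc⟩ := Ideal.mem_span_range_iff_exists_fun.mp
        (hw _ (aeval_eq_zero_of_polyEval_eq_zero hst hδ x hl hker (k := k) (by linarith [hk.1])))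
      exact ⟨c, fun _ => hc, fun h => absurd hk h⟩
    · refine ⟨0, fun hlt => ?_, fun _ => rfl⟩
      have : p k = 0 := by
        by_contra hne
        exact hk ⟨hlt, hne⟩
      simp [this]
  choose c hc hc0 using hcoef
  have hq : ∀ i, IsPolyNov fun k => c k i := fun i =>
    isPolyNov_of_finite_support <| (hp (l + ε)).subset fun k hk => by
      by_contra hne
      exact hk (by simp [hc0 k hne])
  have hql : ∀ i, VanishesBelow l fun k => c k i := fun i k hk => by
    simp [hc0 k fun h => h.2 (hl k hk)]
  refine ⟨_, ⟨fun i k => c k i, hq, rfl⟩, fun k hk => ?_⟩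
  have hterm : ∀ i, polyMul (fun k => c k i) (v i) k = c k i * w i := by
    intro i
    have h0 : polyMul (fun k => c k i) (embedPoly (w i) - v i) k = 0 :=
      (hql i).conv (hε i) (exists_of_polyMul_ne_zero _ _) k hk
    rw [polyMul_sub_right (q := embedPoly (w i)) (hq i).1 (novCondG_constSer _) (hv i).1, Pi.sub_apply,
      polyMul_embedPoly] at h0
    exact (sub_eq_zero.mp h0).symm
  rw [Pi.sub_apply, Finset.sum_apply, Finset.sum_congr rfl fun i _ => hterm i, hc k hk, sub_self]

end Evaluation

/-- Lemma 4.8 (algebraic kernel lemma).  Let `H` be a finite-dimensional commutative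
unital `ℚ`-algebra, `st` a `δ`-deformation (`δ > 0`) of its product, and `x 1, …, x M`
generators of `H` as a `ℚ`-algebra.  If `w 1, …, w m` generate the kernel of
`φ̂ : ℚ[X_1,…,X_M] → H` and `v 1, …, v m ∈ ker Φ̂` satisfy `𝔳_T (w i - v i) > 0`,
then `ker Φ̂ = Clos_{𝔳_T}(⟨v 1, …, v m⟩)`. -/
theorem kernel_of_deformed_evaluation
    {H : Type*} [CommRing H] [Algebra ℚ H] [FiniteDimensional ℚ H]
    {M m : ℕ} (δ : ℝ) (hδ : 0 < δ)
    (st : (ℝ → H) → (ℝ → H) → (ℝ → H))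
    (hst : IsDeltaDeformation δ st)
    (x : Fin M → H) (hgen : Algebra.adjoin ℚ (Set.range x) = ⊤)
    (w : Fin m → MvPolynomial (Fin M) ℚ)
    (hw : ∀ p : MvPolynomial (Fin M) ℚ,
      MvPolynomial.aeval x p = 0 ↔ p ∈ Ideal.span (Set.range w))
    (v : Fin m → ℝ → MvPolynomial (Fin M) ℚ)
    (hvPoly : ∀ i, IsPolyNov (v i))
    (hvKer : ∀ i, polyEval st x (v i) = 0)
    (hwv : ∀ i, 0 < novValE (embedPoly (w i) - v i)) :
    ∀ p : ℝ → MvPolynomial (Fin M) ℚ, IsPolyNov p →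
      (polyEval st x p = 0 ↔ CloMem v p) := by
  intro p hp
  constructor
  · intro hker c
    obtain ⟨ε, hε0, hεδ, hε⟩ : ∃ ε > 0, ε ≤ δ ∧
        ∀ i, VanishesBelow ε (embedPoly (w i) - v i) := by
      choose e he0 he using fun i =>
        exists_pos_vanishesBelow ((novCondG_constSer (w i)).sub (hvPoly i).1) (hwv i)
      have hne : (insert δ (Finset.univ.image e)).Nonempty := Finset.insert_nonempty _ _
      refine ⟨(insert δ (Finset.univ.image e)).min' hne, ?_,
        Finset.min'_le _ _ (Finset.mem_insert_self _ _), fun i => (he i).mono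
          (Finset.min'_le _ _ (Finset.mem_insert_of_mem
            (Finset.mem_image_of_mem e (Finset.mem_univ i))))⟩
      rw [gt_iff_lt, Finset.lt_min'_iff]
      simpa [hδ] using he0
    have approx : ∀ n : ℕ, ∀ p : ℝ → MvPolynomial (Fin M) ℚ, NovCondG p →
        polyEval st x p = 0 → VanishesBelow (c - n * ε) p →
        ∃ j, InIdealGen v j ∧ VanishesBelow c (p - j) := by
      intro n
      induction n with
      | zero =>
        intro p _ _ hl
        exact ⟨0, inIdealGen_zero v, by simpa using hl⟩
      | succ n ih =>
        intro p hp hker hl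
        obtain ⟨j, hj, hpj⟩ := exists_inIdealGen_vanishesBelow_sub hst hδ x
          (fun u => (hw u).mp) hvPoly hεδ hε hp hl hker
        have hjN := hj.novCondG hvPoly
        have hker' : polyEval st x (p - j) = 0 := by
          have h := polyEval_add hst hδ x (hp.sub hjN) hjN
          rwa [sub_add_cancel, hker, hj.polyEval_eq_zero hst hδ x hvPoly hvKer, add_zero,
            eq_comm] at h
        obtain ⟨j', hj', hpj'⟩ := ih (p - j) (hp.sub hjN) hker'
          (hpj.mono (by push_cast; linarith))
        exact ⟨j + j', hj.add hvPoly hj', by rwa [← sub_sub]⟩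
    obtain ⟨l, hl⟩ := hp.1.exists_vanishesBelow
    obtain ⟨n, hn⟩ := exists_nat_ge ((c - l) / ε)
    rw [div_le_iff₀ hε0] at hn
    obtain ⟨j, hj, hpj⟩ := approx n p hp.1 hker (hl.mono (by linarith))
    exact ⟨j, hj, Or.inr hpj.le_novValE⟩
  · intro hclo
    funext k
    obtain ⟨j, hj, hpj⟩ := hclo (k + 1)
    have hj0 := hj.polyEval_eq_zero hst hδ x hvPoly hvKer
    rcases hpj with rfl | hpj
    · rw [hj0]
    · have hjN := hj.novCondG hvPoly
      have h := polyEval_add hst hδ x (hp.1.sub hjN) hjN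
      rw [sub_add_cancel, hj0, add_zero] at h
      rw [h]
      exact (vanishesBelow_of_le_novValE (hp.1.sub hjN) hpj).polyEval hst hδ x k (by linarith)
end

section
/- (Surjectivity part of the proof of Theorem 4.7.) Let H be a finite-dimensional commutative unital ℚ-algebra, let ∗ be a δ-deformation of the product of H on A for some δ > 0, and suppose x_1, …, x_M ∈ H generate H as a ℚ-algebra. Then the Λ^univ-algebra homomorphism Φ̂ : Λ^univ[X_1,…,X_M] → (A, ∗) sending each X_i to x_i is surjective. -/
/-- The `R`-valued Novikov series all of whose exponents are at least `c`. -/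
def novGE (R : Type*) [AddCommGroup R] [Module ℚ R] (c : ℝ) : Submodule ℚ (ℝ → R) where
  carrier := {f | NovCondG f ∧ ∀ k, f k ≠ 0 → c ≤ k}
  zero_mem' := ⟨fun c => by simp, fun k h => absurd rfl h⟩
  add_mem' := by
    rintro f g ⟨hf, hf'⟩ ⟨hg, hg'⟩
    have key : ∀ k, (f + g) k ≠ 0 → f k ≠ 0 ∨ g k ≠ 0 := by
      intro k hk
      by_contra! h
      exact hk (by simp [h.1, h.2])
    refine ⟨fun d => ((hf d).union (hg d)).subset ?_, fun k hk => (key k hk).elim (hf' k) (hg' k)⟩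
    rintro k ⟨hk, hne⟩
    exact (key k hne).imp (⟨hk, ·⟩) (⟨hk, ·⟩)
  smul_mem' := by
    rintro q f ⟨hf, hf'⟩
    have key : ∀ k, (q • f) k ≠ 0 → f k ≠ 0 := by
      intro k hk h
      exact hk (by simp [h])
    exact ⟨fun d => (hf d).subset fun k hk => ⟨hk.1, key k hk.2⟩, fun k hk => hf' k (key k hk)⟩

section NovikovSeries

variable {R : Type*} [AddCommGroup R] [Module ℚ R]

lemma novGE_anti {a b : ℝ} (h : a ≤ b) : novGE R b ≤ novGE R a :=
  fun _ hf => ⟨hf.1, fun k hk => h.trans (hf.2 k hk)⟩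

lemma apply_eq_zero_of_mem_novGE {c k : ℝ} {f : ℝ → R} (hf : f ∈ novGE R c) (hk : k < c) :
    f k = 0 := by
  by_contra h
  exact (hf.2 k h).not_gt hk

lemma NovCondG.exists_mem_novGE {f : ℝ → R} (hf : NovCondG f) : ∃ c, f ∈ novGE R c := by
  obtain ⟨b, hb⟩ := (hf 0).bddBelow
  refine ⟨min b 0, hf, fun k hk => ?_⟩
  rcases lt_or_ge k 0 with h | h
  · exact (min_le_left _ _).trans (hb ⟨h, hk⟩)
  · exact (min_le_right _ _).trans h

lemma comp_mem_novGE {S : Type*} [AddCommGroup S] [Module ℚ S] (g : R →ₗ[ℚ] S) {c : ℝ}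
    {f : ℝ → R} (hf : f ∈ novGE R c) : (fun a => g (f a)) ∈ novGE S c := by
  have key : ∀ k, g (f k) ≠ 0 → f k ≠ 0 := fun k hk h => hk (by simp [h])
  exact ⟨fun d => (hf.1 d).subset fun k hk => ⟨hk.1, key k hk.2⟩, fun k hk => hf.2 k (key k hk)⟩

/-- `constSer` as a linear map. -/
noncomputable def constSerLin (R : Type*) [AddCommGroup R] [Module ℚ R] : R →ₗ[ℚ] (ℝ → R) where
  toFun := constSer
  map_add' x y := by ext k; by_cases h : k = 0 <;> simp [constSer, h]
  map_smul' q x := by ext k; by_cases h : k = 0 <;> simp [constSer, h]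

lemma constSer_mem_novGE (x : R) : constSer x ∈ novGE R 0 := by
  have key : ∀ k, constSer x k ≠ 0 → k = 0 := by
    intro k hk
    by_contra h
    exact hk (by simp [constSer, h])
  exact ⟨fun d => (Set.finite_singleton 0).subset fun k hk => key k hk.2,
    fun k hk => (key k hk).ge⟩

/-- The series `∑ₐ φ a · T^a` attached to a family `φ` of series. -/
noncomputable def shiftSum (φ : ℝ → ℝ → R) : ℝ → R :=
  fun k => ∑ᶠ a : ℝ, φ a (k - a)

lemma shiftSum_support_subset {b : ℝ} {φ : ℝ → ℝ → R} (hb : ∀ x, φ x ∈ novGE R b) (k : ℝ) :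
    (Function.support fun a => φ a (k - a)) ⊆ {a | a < k - b + 1 ∧ φ a ≠ 0} := by
  intro a ha
  have h := (hb a).2 (k - a) ha
  exact ⟨by linarith, fun h0 => ha (by simp [h0])⟩

lemma shiftSum_add {a a' b b' : ℝ} {φ ψ : ℝ → ℝ → R}
    (hφ : φ ∈ novGE (ℝ → R) a) (hφ' : ∀ x, φ x ∈ novGE R b)
    (hψ : ψ ∈ novGE (ℝ → R) a') (hψ' : ∀ x, ψ x ∈ novGE R b') :
    shiftSum (φ + ψ) = shiftSum φ + shiftSum ψ := by
  ext k
  exact finsum_add_distrib ((hφ.1 _).subset (shiftSum_support_subset hφ' k))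
    ((hψ.1 _).subset (shiftSum_support_subset hψ' k))

lemma shiftSum_mem_novGE {a b : ℝ} {φ : ℝ → ℝ → R}
    (hφ : φ ∈ novGE (ℝ → R) a) (hb : ∀ x, φ x ∈ novGE R b) :
    shiftSum φ ∈ novGE R (a + b) := by
  have key : ∀ k, shiftSum φ k ≠ 0 → ∃ x, φ x (k - x) ≠ 0 := by
    intro k hk
    by_contra! h
    exact hk (by simp [shiftSum, h])
  refine ⟨fun d => ?_, fun k hk => ?_⟩
  · refine ((hφ.1 (d - b + 1)).biUnion
      (t := fun x => (fun k => k + x) '' {k | k < d - x ∧ φ x k ≠ 0})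
      fun x _ => ((hb x).1 (d - x)).image _).subset ?_
    rintro k ⟨hk, hne⟩
    obtain ⟨x, hx⟩ := key k hne
    obtain ⟨h1, h2⟩ := shiftSum_support_subset hb k hx
    refine Set.mem_biUnion (x := x) ⟨by linarith, h2⟩ ⟨k - x, ⟨by linarith, hx⟩, by simp⟩
  · obtain ⟨x, hx⟩ := key k hk
    have h1 := (hb x).2 _ hx
    have h2 := hφ.2 x fun h0 => hx (by simp [h0])
    linarith

lemma shiftSum_constSer {S : Type*} [AddCommGroup S] (α : ℝ → S) : shiftSum (fun a => constSer (α a)) = α := by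
  ext k
  rw [shiftSum, finsum_eq_single _ k]
  · simp [constSer]
  · intro a ha
    simp [constSer, sub_eq_zero, ha.symm]

/-- Solvability by successive approximation: a linear map `G` with values in series that is a
perturbation of `constSer` of positive order extends to a surjection on Novikov series. -/
lemma exists_shiftSum_eq {δ : ℝ} (hδ : 0 < δ) (G : R →ₗ[ℚ] (ℝ → R))
    (hG : ∀ x, G x - constSer x ∈ novGE R δ) {α : ℝ → R} (hα : NovCondG α) :
    ∃ F : ℝ → R, NovCondG F ∧ shiftSum (fun a => G (F a)) = α := by
  obtain ⟨c, hc⟩ := hα.exists_mem_novGE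
  set D : R →ₗ[ℚ] (ℝ → R) := constSerLin R - G with hD
  have hDx : ∀ x, D x ∈ novGE R δ := fun x => by
    simpa [hD, constSerLin] using neg_mem (hG x)
  have hG0 : ∀ x, G x ∈ novGE R 0 := fun x => by
    simpa using add_mem (novGE_anti hδ.le (hG x)) (constSer_mem_novGE x)
  have hadd : ∀ {a a' : ℝ} {β γ : ℝ → R}, β ∈ novGE R a → γ ∈ novGE R a' →
      shiftSum (fun x => G ((β + γ) x)) =
        shiftSum (fun x => G (β x)) + shiftSum (fun x => G (γ x)) := by
    intro a a' β γ hβ hγ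
    rw [← shiftSum_add (comp_mem_novGE G hβ) (fun _ => hG0 _) (comp_mem_novGE G hγ)
      (fun _ => hG0 _)]
    congr 1
    ext x : 1
    simp
  have hres : ∀ {a : ℝ} {β : ℝ → R}, β ∈ novGE R a →
      shiftSum (fun x => D (β x)) + shiftSum (fun x => G (β x)) = β := by
    intro a β hβ
    rw [← shiftSum_add (comp_mem_novGE D hβ) (fun _ => hDx _) (comp_mem_novGE G hβ)
      (fun _ => hG0 _)]
    conv_rhs => rw [← shiftSum_constSer β]
    congr 1
    ext x : 1
    simp [hD, constSerLin]
  let u : ℕ → ℝ → R := fun n => (fun β => shiftSum fun x => D (β x))^[n] α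
  have hsucc : ∀ n, u (n + 1) = shiftSum fun x => D (u n x) := fun n =>
    Function.iterate_succ_apply' _ _ _
  have hu : ∀ n : ℕ, u n ∈ novGE R (c + n * δ) := by
    intro n
    induction n with
    | zero => simpa [u] using hc
    | succ n ih =>
      rw [hsucc]
      convert shiftSum_mem_novGE (comp_mem_novGE D ih) (fun _ => hDx _) using 2
      push_cast
      ring
  have huc : ∀ n : ℕ, u n ∈ novGE R c := fun n =>
    novGE_anti (le_add_of_nonneg_right (by positivity)) (hu n)
  have hpart : ∀ N : ℕ,
      shiftSum (fun x => G ((∑ n ∈ Finset.range N, u n) x)) + u N = α := by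
    intro N
    induction N with
    | zero =>
      ext k
      simp [u, shiftSum]
    | succ N ih =>
      rw [Finset.sum_range_succ, hadd (sum_mem fun n _ => huc n) (huc N), hsucc]
      rw [← hres (hu N)] at ih
      rw [← ih]
      abel
  let F : ℝ → R := fun k => ∑ᶠ n, u n k
  have hF : ∀ (N : ℕ) (k : ℝ), k < c + N * δ → F k = (∑ n ∈ Finset.range N, u n) k := by
    intro N k hk
    rw [Finset.sum_apply]
    refine finsum_eq_sum_of_support_subset _ fun n hn => ?_
    by_contra h
    have h' : N ≤ n := by simpa using h
    have h2 : (N : ℝ) * δ ≤ n * δ := by gcongr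
    exact hn (apply_eq_zero_of_mem_novGE (hu n) (by linarith))
  have hbig : ∀ k : ℝ, ∃ N : ℕ, k < c + N * δ := by
    intro k
    obtain ⟨N, hN⟩ := exists_nat_gt ((k - c) / δ)
    rw [div_lt_iff₀ hδ] at hN
    exact ⟨N, by linarith⟩
  have hFN : NovCondG F := by
    intro d
    obtain ⟨N, hN⟩ := hbig d
    refine ((sum_mem fun n _ => huc n : ∑ n ∈ Finset.range N, u n ∈ novGE R c).1 d).subset ?_
    rintro k ⟨hk, hne⟩
    exact ⟨hk, by rwa [← hF N k (hk.trans hN)]⟩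
  refine ⟨F, hFN, ?_⟩
  ext k
  obtain ⟨N, hN⟩ := hbig k
  obtain ⟨d, hd⟩ := hFN.exists_mem_novGE
  set P := ∑ n ∈ Finset.range N, u n with hP
  have hPc : P ∈ novGE R c := sum_mem fun n _ => huc n
  have hrest : F - P ∈ novGE R (c + N * δ) := by
    refine ⟨(sub_mem (novGE_anti (min_le_left d c) hd) (novGE_anti (min_le_right d c) hPc)).1,
      fun k' hk' => ?_⟩
    by_contra! h
    exact hk' (by rw [Pi.sub_apply, hF N k' h, sub_self])
  have h1 := hadd hPc hrest
  rw [add_sub_cancel] at h1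
  have h2 := shiftSum_mem_novGE (comp_mem_novGE G hrest) (fun _ => hG0 _)
  rw [add_zero] at h2
  rw [h1, Pi.add_apply, apply_eq_zero_of_mem_novGE h2 hN, add_zero]
  conv_rhs => rw [← hpart N]
  rw [Pi.add_apply, apply_eq_zero_of_mem_novGE (hu N) hN, add_zero]

end NovikovSeries

lemma mem_novGE_of_le_novValE {R : Type*} [AddCommGroup R] [Module ℚ R] {δ : ℝ} {f : ℝ → R}
    (hf : NovCondG f) (h : (δ : EReal) ≤ novValE f) : f ∈ novGE R δ := by
  refine ⟨hf, fun k hk => ?_⟩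
  have hne : f ≠ 0 := fun h0 => hk (by simp [h0])
  rw [novValE, if_neg hne, EReal.coe_le_coe_iff] at h
  obtain ⟨c, hc⟩ := hf.exists_mem_novGE
  exact h.trans (csInf_le ⟨c, fun x hx => hc.2 x hx⟩ hk)

namespace IsDeltaDeformation

variable {H : Type*} [CommRing H] [Algebra ℚ H] {δ : ℝ}
  {st : (ℝ → H) → (ℝ → H) → (ℝ → H)}

lemma nov (hst : IsDeltaDeformation δ st) {α β : ℝ → H} (hα : NovCondG α) (hβ : NovCondG β) :
    NovCondG (st α β) := hst.1 α β hα hβ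

lemma comm (hst : IsDeltaDeformation δ st) {α β : ℝ → H} (hα : NovCondG α) (hβ : NovCondG β) :
    st α β = st β α := hst.2.1 α β hα hβ

lemma add_left (hst : IsDeltaDeformation δ st) {α β γ : ℝ → H} (hα : NovCondG α)
    (hβ : NovCondG β) (hγ : NovCondG γ) : st (α + β) γ = st α γ + st β γ :=
  hst.2.2.2.1 α β γ hα hβ hγ

lemma zero_left (hst : IsDeltaDeformation δ st) {β : ℝ → H} (hβ : NovCondG β) :
    st 0 β = 0 := by
  have h := hst.add_left (zero_mem (novGE H 0)).1 (zero_mem (novGE H 0)).1 hβ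
  simpa using h

lemma sum_left (hst : IsDeltaDeformation δ st) {ι : Type*} (s : Finset ι) {f : ι → ℝ → H}
    {c : ℝ} (hf : ∀ i, f i ∈ novGE H c) {β : ℝ → H} (hβ : NovCondG β) :
    st (∑ i ∈ s, f i) β = ∑ i ∈ s, st (f i) β := by
  classical
  induction s using Finset.induction_on with
  | empty => simpa using hst.zero_left hβ
  | insert i s hi ih =>
    rw [Finset.sum_insert hi, Finset.sum_insert hi,
      hst.add_left (hf i).1 (sum_mem fun j _ => hf j).1 hβ, ih]

lemma const_mul_sub_mem (hst : IsDeltaDeformation δ st) (x y : H) :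
    st (constSer x) (constSer y) - constSer (x * y) ∈ novGE H δ := by
  have h0 : (constSer (0 : H)) = 0 := map_zero (constSerLin H)
  have hN : ∀ z : H, NovCondG (constSer z) := fun z => (constSer_mem_novGE z).1
  by_cases hx : x = 0
  · simp [hx, h0, hst.zero_left (hN y)]
  by_cases hy : y = 0
  · rw [hst.comm (hN x) (hN y)]
    simp [hy, h0, hst.zero_left (hN x)]
  obtain ⟨c, hc⟩ := (hst.nov (hN x) (hN y)).exists_mem_novGE
  exact mem_novGE_of_le_novValE (sub_mem (novGE_anti (min_le_left c 0) hc)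
    (novGE_anti (min_le_right c 0) (constSer_mem_novGE (x * y)))).1 (hst.2.2.2.2.2.2 x y hx hy)

lemma convQ_mem_novGE {a b : ℝ} {f : ℝ → ℚ} {α : ℝ → H} (hf : f ∈ novGE ℚ a)
    (hα : α ∈ novGE H b) : convQ f α ∈ novGE H (a + b) :=
  shiftSum_mem_novGE (comp_mem_novGE (LinearMap.toSpanSingleton ℚ (ℝ → H) α) hf)
    fun x => (novGE H b).smul_mem (f x) hα

lemma convQ_constSer (f : ℝ → ℚ) (x : H) : convQ f (constSer x) = fun k => f k • x := by
  conv_rhs => rw [← shiftSum_constSer fun k => f k • x]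
  have h : ∀ a, constSer (f a • x) = f a • constSer x := fun a =>
    map_smul (constSerLin H) (f a) x
  simp only [h]
  rfl

variable [FiniteDimensional ℚ H]

lemma mul_mem_novGE_of_const (hst : IsDeltaDeformation δ st) {a b : ℝ} {α β : ℝ → H}
    (hα : α ∈ novGE H a) (hβ : NovCondG β) (h : ∀ x : H, st (constSer x) β ∈ novGE H b) :
    st α β ∈ novGE H (a + b) := by
  let B := Module.finBasis ℚ H
  let f : Fin (Module.finrank ℚ H) → ℝ → ℚ := fun i k => B.coord i (α k)
  have hf : ∀ i, f i ∈ novGE ℚ a := fun i => comp_mem_novGE (B.coord i) hα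
  have hdec : α = ∑ i, convQ (f i) (constSer (B i)) := by
    ext k
    simp [convQ_constSer, f, B.sum_repr]
  rw [hdec, hst.sum_left _ (fun i => convQ_mem_novGE (hf i) (constSer_mem_novGE (B i))) hβ]
  refine sum_mem fun i _ => ?_
  rw [hst.2.2.2.2.1 _ _ _ (hf i).1 (constSer_mem_novGE (B i)).1 hβ]
  exact convQ_mem_novGE (hf i) (h _)

lemma mul_mem_novGE (hst : IsDeltaDeformation δ st) (hδ : 0 ≤ δ) {a b : ℝ} {α β : ℝ → H}
    (hα : α ∈ novGE H a) (hβ : β ∈ novGE H b) : st α β ∈ novGE H (a + b) := by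
  refine hst.mul_mem_novGE_of_const hα hβ.1 fun x => ?_
  rw [hst.comm (constSer_mem_novGE x).1 hβ.1, ← add_zero b]
  refine hst.mul_mem_novGE_of_const hβ (constSer_mem_novGE x).1 fun y => ?_
  simpa using add_mem (novGE_anti hδ (hst.const_mul_sub_mem y x)) (constSer_mem_novGE (y * x))

lemma mul_sub_mem (hst : IsDeltaDeformation δ st) (hδ : 0 ≤ δ) {α β : ℝ → H} {x y : H}
    (hα : α - constSer x ∈ novGE H δ) (hβ : β - constSer y ∈ novGE H δ) :
    st α β - constSer (x * y) ∈ novGE H δ := by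
  have hx := constSer_mem_novGE x
  have hy := constSer_mem_novGE y
  have hβ0 : β ∈ novGE H 0 := by simpa using add_mem (novGE_anti hδ hβ) hy
  have h1 : st α β = st (α - constSer x) β + st (constSer x) β := by
    rw [← hst.add_left hα.1 hx.1 hβ0.1, sub_add_cancel]
  have h2 : st (constSer x) β = st (β - constSer y) (constSer x) + st (constSer x) (constSer y) := by
    rw [hst.comm hx.1 hβ0.1, hst.comm hx.1 hy.1, ← hst.add_left hβ.1 hy.1 hx.1, sub_add_cancel]
  have h3 := hst.mul_mem_novGE hδ hα hβ0
  have h4 := hst.mul_mem_novGE hδ hβ hx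
  rw [add_zero] at h3 h4
  rw [h1, h2, add_sub_assoc, add_sub_assoc]
  exact add_mem h3 (add_mem h4 (hst.const_mul_sub_mem x y))

lemma starPow_sub_mem (hst : IsDeltaDeformation δ st) (hδ : 0 ≤ δ) (x : H) (n : ℕ) :
    starPow st (constSer x) n - constSer (x ^ n) ∈ novGE H δ := by
  induction n with
  | zero => simp [starPow]
  | succ n ih =>
    rw [starPow, pow_succ']
    exact hst.mul_sub_mem hδ (by simp) ih

lemma monEval_sub_mem (hst : IsDeltaDeformation δ st) (hδ : 0 ≤ δ) {M : ℕ} (x : Fin M → H)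
    (mo : Fin M →₀ ℕ) : monEval st x mo - constSer (∏ i, x i ^ mo i) ∈ novGE H δ := by
  rw [monEval, Fin.prod_univ_def]
  induction List.finRange M with
  | nil => simp
  | cons i l ih =>
    rw [List.foldr_cons, List.map_cons, List.prod_cons]
    exact hst.mul_sub_mem hδ (hst.starPow_sub_mem hδ _ _) ih

end IsDeltaDeformation

/-- The `ℚ`-linear extension of `monEval` to polynomials with rational coefficients. -/
noncomputable def monEvalLin {H : Type*} [CommRing H] [Algebra ℚ H] {M : ℕ}
    (st : (ℝ → H) → (ℝ → H) → (ℝ → H)) (x : Fin M → H) :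
    MvPolynomial (Fin M) ℚ →ₗ[ℚ] (ℝ → H) :=
  (MvPolynomial.basisMonomials (Fin M) ℚ).constr ℚ (monEval st x)

lemma monEvalLin_apply {H : Type*} [CommRing H] [Algebra ℚ H] {M : ℕ}
    (st : (ℝ → H) → (ℝ → H) → (ℝ → H)) (x : Fin M → H) (p : MvPolynomial (Fin M) ℚ) :
    monEvalLin st x p = ∑ mo ∈ p.support, MvPolynomial.coeff mo p • monEval st x mo := by
  rw [monEvalLin, Module.Basis.constr_apply]
  rfl

lemma IsDeltaDeformation.monEvalLin_sub_mem {H : Type*} [CommRing H] [Algebra ℚ H]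
    [FiniteDimensional ℚ H] {δ : ℝ} {st : (ℝ → H) → (ℝ → H) → (ℝ → H)}
    (hst : IsDeltaDeformation δ st) (hδ : 0 ≤ δ) {M : ℕ} (x : Fin M → H)
    (p : MvPolynomial (Fin M) ℚ) :
    monEvalLin st x p - constSer (MvPolynomial.aeval x p) ∈ novGE H δ := by
  have h : constSer (MvPolynomial.aeval x p) =
      ∑ mo ∈ p.support, MvPolynomial.coeff mo p • constSer (∏ i, x i ^ mo i) := by
    rw [MvPolynomial.aeval_def, MvPolynomial.eval₂_eq']
    simp only [← Algebra.smul_def]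
    change constSerLin H _ = ∑ mo ∈ p.support, _ • constSerLin H _
    simp only [map_sum, map_smul]
  rw [monEvalLin_apply, h, ← Finset.sum_sub_distrib]
  refine sum_mem fun mo _ => ?_
  rw [← smul_sub]
  exact Submodule.smul_mem _ _ (hst.monEval_sub_mem hδ x mo)

lemma LinearMap.finite_iUnion_support {σ V : Type*} [AddCommGroup V] [Module ℚ V]
    [FiniteDimensional ℚ V] (s : V →ₗ[ℚ] MvPolynomial σ ℚ) :
    (⋃ v, ((s v).support : Set (σ →₀ ℕ))).Finite := by
  let B := Module.finBasis ℚ V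
  refine (Set.finite_iUnion fun i => (s (B i)).support.finite_toSet).subset ?_
  refine Set.iUnion_subset fun v mo hmo => ?_
  by_contra! h
  simp only [Set.mem_iUnion, not_exists, Finset.mem_coe, MvPolynomial.notMem_support_iff] at h
  refine MvPolynomial.mem_support_iff.mp hmo ?_
  rw [← B.sum_repr v, map_sum, MvPolynomial.coeff_sum]
  exact Finset.sum_eq_zero fun i _ => by rw [map_smul, MvPolynomial.coeff_smul, h i, smul_zero]

/-- Surjectivity part of the proof of Theorem 4.7: if `H` is a finite-dimensional
commutative unital `ℚ`-algebra, `st` a `δ`-deformation (`δ > 0`) of its product, and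
`x 1, …, x M` generate `H` as a `ℚ`-algebra, then the evaluation homomorphism
`Φ̂ : Λ^univ[X_1,…,X_M] → (A, ∗)`, `X_i ↦ x i`, is surjective. -/
theorem deformed_evaluation_surjective
    {H : Type*} [CommRing H] [Algebra ℚ H] [FiniteDimensional ℚ H]
    {M : ℕ} (δ : ℝ) (hδ : 0 < δ)
    (st : (ℝ → H) → (ℝ → H) → (ℝ → H))
    (hst : IsDeltaDeformation δ st)
    (x : Fin M → H) (hgen : Algebra.adjoin ℚ (Set.range x) = ⊤) :
    ∀ α : ℝ → H, NovCondG α →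
      ∃ p : ℝ → MvPolynomial (Fin M) ℚ, IsPolyNov p ∧ polyEval st x p = α := by
  intro α hα
  have hsurj : Function.Surjective (MvPolynomial.aeval (R := ℚ) x).toLinearMap := by
    intro y
    have hy : y ∈ Algebra.adjoin ℚ (Set.range x) := hgen ▸ Algebra.mem_top
    rwa [Algebra.adjoin_range_eq_range_aeval] at hy
  obtain ⟨s, hs⟩ := LinearMap.exists_rightInverse_of_surjective _
    (LinearMap.range_eq_top.mpr hsurj)
  have hs' : ∀ y, MvPolynomial.aeval x (s y) = y := fun y => LinearMap.congr_fun hs y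
  obtain ⟨F, hF, hFα⟩ := exists_shiftSum_eq hδ (monEvalLin st x ∘ₗ s)
    (fun y => by simpa [hs'] using hst.monEvalLin_sub_mem hδ.le x (s y)) hα
  obtain ⟨c, hc⟩ := hF.exists_mem_novGE
  refine ⟨fun a => s (F a), ⟨(comp_mem_novGE s hc).1, ?_⟩, ?_⟩
  · exact s.finite_iUnion_support.subset
      (Set.iUnion_subset fun a => Set.subset_iUnion (fun v => ((s v).support : Set (Fin M →₀ ℕ))) (F a))
  · rw [← hFα]
    ext k
    simp [polyEval, shiftSum, monEvalLin_apply]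
end
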